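/- arXiv:math/0310005 — 2 statements merged into one kernel-verified Lean document; each statement's English description precedes it below -/
import Mathlib

section
/- Let F = {f_n(q)}_{n=1}^∞ be a sequence of rational functions over ℚ satisfying the functional equation for multiplication of quantum integers, with supp(F) = S(P) for a set P of primes with at least two elements. Suppose that for every prime p ∈ P there are disjoint nonempty finite multisets U_p and V_p of positive integers (V_p possibly empty, U_p ∪ V_p nonempty) such that f_p(q) = ∏_{u∈U_p}(q^u − 1) / ∏_{v∈V_p}(q^v − 1), and set m_p = max(U_p ∪ V_p). Then there exists a positive integer r such that m_p = r·p for every p ∈ P; moreover, either m_p ∈ U_p for all p ∈ P, or m_p ∈ V_p for all p ∈ P. -/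
open Polynomial

/-- `S(P)`: the multiplicative semigroup of positive integers generated by the
set `P` of primes, i.e. the positive integers all of whose prime factors lie in `P`. -/
def SP (P : Set ℕ) : Set ℕ :=
  {n : ℕ | 0 < n ∧ ∀ p : ℕ, p.Prime → p ∣ n → p ∈ P}

/-- Substitution of `q^m` for the variable `q` in a rational function `f ∈ RatFunc ℚ`:
`f(q^m) = num(q^m) / denom(q^m)`. -/
noncomputable def qSubst (m : ℕ) (f : RatFunc ℚ) : RatFunc ℚ :=
  (f.num.eval₂ RatFunc.C (RatFunc.X ^ m)) / (f.denom.eval₂ RatFunc.C (RatFunc.X ^ m))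

/-- A sequence of rational functions satisfies the functional equation for
multiplication of quantum integers if `f_{mn}(q) = f_m(q) · f_n(q^m)` for all
positive integers `m` and `n`. -/
def SatisfiesFE (f : ℕ → RatFunc ℚ) : Prop :=
  ∀ m n : ℕ, 0 < m → 0 < n → f (m * n) = f m * qSubst m (f n)

/-- The product `∏_{u ∈ U} (q^u - 1)` over a multiset of exponents. -/
noncomputable def powSubOneProd (U : Multiset ℕ) : ℚ[X] :=
  (U.map (fun u => (X : ℚ[X]) ^ u - 1)).prod

theorem X_pow_sub_one_ne_zero {u : ℕ} (hu : 0 < u) : (X : ℚ[X]) ^ u - 1 ≠ 0 := by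
  simpa using X_pow_sub_C_ne_zero hu (1 : ℚ)

theorem powSubOneProd_ne_zero {U : Multiset ℕ} (hU : ∀ u ∈ U, 0 < u) :
    powSubOneProd U ≠ 0 := by
  refine Multiset.prod_ne_zero fun h => ?_
  obtain ⟨u, hu, h0⟩ := Multiset.mem_map.1 h
  exact X_pow_sub_one_ne_zero (hU u hu) h0

theorem powSubOneProd_add (U V : Multiset ℕ) :
    powSubOneProd (U + V) = powSubOneProd U * powSubOneProd V := by
  simp [powSubOneProd]

theorem expand_powSubOneProd (m : ℕ) (U : Multiset ℕ) :
    expand ℚ m (powSubOneProd U) = powSubOneProd (U.map (m * ·)) := by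
  simp [powSubOneProd, map_multiset_prod, Multiset.map_map, pow_mul]

theorem rootMultiplicity_X_pow_sub_one {N u : ℕ} (hu : 0 < u) {ζ : ℂ}
    (hζ : IsPrimitiveRoot ζ N) :
    rootMultiplicity ζ ((X : ℂ[X]) ^ u - 1) = if N ∣ u then 1 else 0 := by
  have h0 : (X : ℂ[X]) ^ u - 1 ≠ 0 := by simpa using X_pow_sub_C_ne_zero hu (1 : ℂ)
  split_ifs with h
  · have hsep : ((X : ℂ[X]) ^ u - 1).Separable :=
      X_pow_sub_one_separable_iff.2 (by exact_mod_cast hu.ne')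
    refine le_antisymm (rootMultiplicity_le_one_of_separable hsep ζ) ?_
    refine (rootMultiplicity_pos h0).2 ?_
    simp [IsRoot, (hζ.pow_eq_one_iff_dvd u).2 h]
  · refine rootMultiplicity_eq_zero fun hr => h ((hζ.pow_eq_one_iff_dvd u).1 ?_)
    simpa [IsRoot, sub_eq_zero] using hr

/-- The multiplicity of a primitive `N`-th root of unity in `∏ (q^u - 1)` is the number of
exponents divisible by `N`. -/
theorem rootMultiplicity_powSubOneProd {N : ℕ} {ζ : ℂ} (hζ : IsPrimitiveRoot ζ N)
    (U : Multiset ℕ) (hU : ∀ u ∈ U, 0 < u) :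
    rootMultiplicity ζ ((powSubOneProd U).map (algebraMap ℚ ℂ)) = U.countP (N ∣ ·) := by
  induction U using Multiset.induction_on with
  | empty => simp [powSubOneProd]
  | cons a s ih =>
    have hs : ∀ u ∈ s, 0 < u := fun u hu => hU u (Multiset.mem_cons_of_mem hu)
    have ha : 0 < a := hU a (Multiset.mem_cons_self a s)
    have hmul : powSubOneProd (a ::ₘ s) = (X ^ a - 1) * powSubOneProd s := by
      simp [powSubOneProd]
    have hne : ((X : ℚ[X]) ^ a - 1) * powSubOneProd s ≠ 0 :=
      mul_ne_zero (X_pow_sub_one_ne_zero ha) (powSubOneProd_ne_zero hs)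
    have hne' := (Polynomial.map_ne_zero_iff (algebraMap ℚ ℂ).injective).2 hne
    rw [hmul]
    rw [Polynomial.map_mul] at hne' ⊢
    rw [rootMultiplicity_mul hne', ih hs, Multiset.countP_cons, add_comm]
    congr 1
    simpa using rootMultiplicity_X_pow_sub_one ha hζ

theorem countP_dvd_eq_count {N : ℕ} {U : Multiset ℕ} (hU : ∀ u ∈ U, 0 < u)
    (hN : ∀ u ∈ U, u ≤ N) : U.countP (N ∣ ·) = U.count N := by
  rw [Multiset.count]
  refine Multiset.countP_congr rfl fun u hu => propext ⟨fun h => ?_, fun h => h ▸ dvd_rfl⟩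
  exact le_antisymm (Nat.le_of_dvd (hU u hu) h) (hN u hu)

theorem count_eq_of_powSubOneProd_eq {N : ℕ} (hN : 0 < N) {U V : Multiset ℕ}
    (hU : ∀ u ∈ U, 0 < u ∧ u ≤ N) (hV : ∀ v ∈ V, 0 < v ∧ v ≤ N)
    (h : powSubOneProd U = powSubOneProd V) : U.count N = V.count N := by
  have hζ := Complex.isPrimitiveRoot_exp N hN.ne'
  rw [← countP_dvd_eq_count (fun u hu => (hU u hu).1) (fun u hu => (hU u hu).2),
    ← countP_dvd_eq_count (fun v hv => (hV v hv).1) (fun v hv => (hV v hv).2),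
    ← rootMultiplicity_powSubOneProd hζ U (fun u hu => (hU u hu).1),
    ← rootMultiplicity_powSubOneProd hζ V (fun v hv => (hV v hv).1), h]

theorem eval₂_C_X_pow (m : ℕ) (p : ℚ[X]) :
    p.eval₂ RatFunc.C (RatFunc.X ^ m) = algebraMap ℚ[X] (RatFunc ℚ) (expand ℚ m p) := by
  rw [expand_eq_sum, eval₂_eq_sum, Polynomial.sum_def, Polynomial.sum_def, map_sum]
  simp [RatFunc.algebraMap_C, RatFunc.algebraMap_X]

theorem qSubst_div {m : ℕ} (hm : 0 < m) {f : RatFunc ℚ} {A B : ℚ[X]} (hB : B ≠ 0)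
    (h : f = algebraMap ℚ[X] (RatFunc ℚ) A / algebraMap ℚ[X] (RatFunc ℚ) B) :
    qSubst m f = algebraMap ℚ[X] (RatFunc ℚ) (expand ℚ m A) /
      algebraMap ℚ[X] (RatFunc ℚ) (expand ℚ m B) := by
  have key := (RatFunc.num_mul_eq_mul_denom_iff hB).2 h
  rw [qSubst, eval₂_C_X_pow, eval₂_C_X_pow, div_eq_div_iff, ← map_mul, ← map_mul, ← map_mul,
    ← map_mul, key]
  · exact RatFunc.algebraMap_ne_zero ((expand_ne_zero hm).2 f.denom_ne_zero)
  · exact RatFunc.algebraMap_ne_zero ((expand_ne_zero hm).2 hB)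

theorem powSubOneProd_eq_of_commute {f : ℕ → RatFunc ℚ} (hf : SatisfiesFE f) {p s : ℕ}
    (hp : 0 < p) (hs : 0 < s) {U V U' V' : Multiset ℕ}
    (hV : ∀ v ∈ V, 0 < v) (hV' : ∀ v ∈ V', 0 < v)
    (hfp : f p = algebraMap ℚ[X] (RatFunc ℚ) (powSubOneProd U) /
      algebraMap ℚ[X] (RatFunc ℚ) (powSubOneProd V))
    (hfs : f s = algebraMap ℚ[X] (RatFunc ℚ) (powSubOneProd U') /
      algebraMap ℚ[X] (RatFunc ℚ) (powSubOneProd V')) :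
    powSubOneProd (U + U'.map (p * ·) + (V' + V.map (s * ·))) =
      powSubOneProd (U' + U.map (s * ·) + (V + V'.map (p * ·))) := by
  have h := (hf p s hp hs).symm.trans ((congrArg f (mul_comm p s)).trans (hf s p hs hp))
  have hV0 := powSubOneProd_ne_zero hV
  have hV0' := powSubOneProd_ne_zero hV'
  rw [qSubst_div hp hV0' hfs, qSubst_div hs hV0 hfp, hfp, hfs, div_mul_div_comm,
    div_mul_div_comm, div_eq_div_iff] at h
  · simp only [← map_mul] at h
    have h' := RatFunc.algebraMap_injective ℚ h
    simpa only [expand_powSubOneProd, ← powSubOneProd_add] using h'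
  · exact mul_ne_zero (RatFunc.algebraMap_ne_zero hV0)
      (RatFunc.algebraMap_ne_zero ((expand_ne_zero hp).2 hV0'))
  · exact mul_ne_zero (RatFunc.algebraMap_ne_zero hV0')
      (RatFunc.algebraMap_ne_zero ((expand_ne_zero hs).2 hV0))

theorem count_map_mul_left {k : ℕ} (hk : 0 < k) (U : Multiset ℕ) (n : ℕ) :
    (U.map (k * ·)).count (k * n) = U.count n :=
  Multiset.count_map_eq_count' _ U (fun _ _ h => Nat.eq_of_mul_eq_mul_left hk h) n

theorem Multiset.sup_mem_of_ne_zero {U : Multiset ℕ} (hU : U ≠ 0) : U.sup ∈ U := by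
  induction U using Multiset.induction_on with
  | empty => exact absurd rfl hU
  | cons a s ih =>
    rw [Multiset.sup_cons]
    rcases le_total s.sup a with h | h
    · simp [sup_eq_left.2 h]
    · rw [sup_eq_right.2 h]
      rcases eq_or_ne s 0 with rfl | hs
      · have : a = 0 := by simpa using h
        simp [this]
      · exact Multiset.mem_cons_of_mem (ih hs)

theorem Multiset.count_eq_zero_of_lt {U : Multiset ℕ} {M n : ℕ} (hU : ∀ u ∈ U, u ≤ M)
    (h : M < n) : U.count n = 0 :=
  Multiset.count_eq_zero.2 fun hn => absurd (hU n hn) (not_le.2 h)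

theorem Multiset.count_map_mul_eq_zero_of_lt {U : Multiset ℕ} {k M n : ℕ}
    (hU : ∀ u ∈ U, u ≤ M) (h : k * M < n) : (U.map (k * ·)).count n = 0 := by
  refine Multiset.count_eq_zero_of_lt (M := k * M) (fun x hx => ?_) h
  obtain ⟨u, hu, rfl⟩ := Multiset.mem_map.1 hx
  exact Nat.mul_le_mul_left k (hU u hu)

/-- Comparison of the largest exponents on both sides of
`f_p(q) f_s(q^p) = f_s(q) f_p(q^s)`. -/
theorem count_max_exponent {f : ℕ → RatFunc ℚ} (hf : SatisfiesFE f) {p s : ℕ}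
    (hp : 1 < p) (hs : 1 < s) {U V U' V' : Multiset ℕ} {M M' : ℕ} (hM' : 0 < M')
    (hU : ∀ u ∈ U, 0 < u ∧ u ≤ M) (hV : ∀ v ∈ V, 0 < v ∧ v ≤ M)
    (hU' : ∀ u ∈ U', 0 < u ∧ u ≤ M') (hV' : ∀ v ∈ V', 0 < v ∧ v ≤ M')
    (hfp : f p = algebraMap ℚ[X] (RatFunc ℚ) (powSubOneProd U) /
      algebraMap ℚ[X] (RatFunc ℚ) (powSubOneProd V))
    (hfs : f s = algebraMap ℚ[X] (RatFunc ℚ) (powSubOneProd U') /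
      algebraMap ℚ[X] (RatFunc ℚ) (powSubOneProd V'))
    (hle : s * M ≤ p * M') :
    U'.count M' + (V.map (s * ·)).count (p * M') =
      (U.map (s * ·)).count (p * M') + V'.count M' := by
  have hp0 : 0 < p := by omega
  have hs0 : 0 < s := by omega
  have hN : 0 < p * M' := Nat.mul_pos hp0 hM'
  have hM'N : M' < p * M' := by nlinarith
  have hMN : M < p * M' := by
    rcases Nat.eq_zero_or_pos M with rfl | h
    · exact hN
    · nlinarith
  have low {W : Multiset ℕ} {K : ℕ} (hW : ∀ u ∈ W, 0 < u ∧ u ≤ K) (hK : K < p * M') :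
      ∀ u ∈ W, 0 < u ∧ u ≤ p * M' :=
    fun u hu => ⟨(hW u hu).1, (hW u hu).2.trans hK.le⟩
  have dil {W : Multiset ℕ} {K k : ℕ} (hk : 0 < k) (hW : ∀ u ∈ W, 0 < u ∧ u ≤ K)
      (hK : k * K ≤ p * M') : ∀ u ∈ W.map (k * ·), 0 < u ∧ u ≤ p * M' := by
    intro x hx
    obtain ⟨u, hu, rfl⟩ := Multiset.mem_map.1 hx
    exact ⟨Nat.mul_pos hk (hW u hu).1, (Nat.mul_le_mul_left k (hW u hu).2).trans hK⟩
  have both {W Z : Multiset ℕ} (hW : ∀ u ∈ W, 0 < u ∧ u ≤ p * M')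
      (hZ : ∀ u ∈ Z, 0 < u ∧ u ≤ p * M') : ∀ u ∈ W + Z, 0 < u ∧ u ≤ p * M' :=
    fun u hu => (Multiset.mem_add.1 hu).elim (hW u) (hZ u)
  have h := count_eq_of_powSubOneProd_eq hN
    (both (both (low hU hMN) (dil hp0 hU' le_rfl)) (both (low hV' hM'N) (dil hs0 hV hle)))
    (both (both (low hU' hM'N) (dil hs0 hU hle)) (both (low hV hMN) (dil hp0 hV' le_rfl)))
    (powSubOneProd_eq_of_commute hf hp0 hs0 (fun v hv => (hV v hv).1)
      (fun v hv => (hV' v hv).1) hfp hfs)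
  simpa only [Multiset.count_add, count_map_mul_left hp0,
    Multiset.count_eq_zero_of_lt (fun u hu => (hU u hu).2) hMN,
    Multiset.count_eq_zero_of_lt (fun u hu => (hV u hu).2) hMN,
    Multiset.count_eq_zero_of_lt (fun u hu => (hU' u hu).2) hM'N,
    Multiset.count_eq_zero_of_lt (fun u hu => (hV' u hu).2) hM'N, zero_add] using h

/-- Let `F = {f_n(q)}` satisfy the functional equation with `supp(F) = S(P)`,
`card(P) ≥ 2`.  Suppose that for every prime `p ∈ P`,
`f_p(q) = ∏_{u ∈ U_p}(q^u − 1) / ∏_{v ∈ V_p}(q^v − 1)` with `U_p, V_p` disjoint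
multisets of positive integers whose union is nonempty, and let
`m_p = max(U_p ∪ V_p)`.  Then there is a positive integer `r` with `m_p = r·p`
for every `p ∈ P`, and either `m_p ∈ U_p` for all `p ∈ P` or `m_p ∈ V_p` for
all `p ∈ P`. -/
theorem max_exponent_structure (f : ℕ → RatFunc ℚ) (hf : SatisfiesFE f)
    (P : Set ℕ) (hP : ∀ p ∈ P, p.Prime) (hP2 : P.Nontrivial)
    (hsupp : ∀ n : ℕ, 0 < n → (f n ≠ 0 ↔ n ∈ SP P))
    (U V : ℕ → Multiset ℕ)
    (hpos : ∀ p ∈ P, (∀ u ∈ U p, 0 < u) ∧ (∀ v ∈ V p, 0 < v))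
    (hdisj : ∀ p ∈ P, Disjoint (U p) (V p))
    (hne : ∀ p ∈ P, U p + V p ≠ 0)
    (hrep : ∀ p ∈ P,
      f p = (algebraMap (Polynomial ℚ) (RatFunc ℚ)
                ((U p).map (fun u => (X : Polynomial ℚ) ^ u - 1)).prod) /
            (algebraMap (Polynomial ℚ) (RatFunc ℚ)
                ((V p).map (fun v => (X : Polynomial ℚ) ^ v - 1)).prod)) :
    ∃ r : ℕ, 0 < r ∧ (∀ p ∈ P, (U p + V p).sup = r * p) ∧
      ((∀ p ∈ P, (U p + V p).sup ∈ U p) ∨ (∀ p ∈ P, (U p + V p).sup ∈ V p)) := by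
  have hmem : ∀ p ∈ P, (U p + V p).sup ∈ U p ∨ (U p + V p).sup ∈ V p := fun p hp =>
    Multiset.mem_add.1 (Multiset.sup_mem_of_ne_zero (hne p hp))
  have hUb : ∀ p ∈ P, ∀ u ∈ U p, 0 < u ∧ u ≤ (U p + V p).sup := fun p hp u hu =>
    ⟨(hpos p hp).1 u hu, Multiset.le_sup (Multiset.mem_add.2 (Or.inl hu))⟩
  have hVb : ∀ p ∈ P, ∀ v ∈ V p, 0 < v ∧ v ≤ (U p + V p).sup := fun p hp v hv =>
    ⟨(hpos p hp).2 v hv, Multiset.le_sup (Multiset.mem_add.2 (Or.inr hv))⟩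
  have hMpos : ∀ p ∈ P, 0 < (U p + V p).sup := fun p hp =>
    (hmem p hp).elim (fun h => (hUb p hp _ h).1) (fun h => (hVb p hp _ h).1)
  have hnot : ∀ p ∈ P, ∀ n ∈ U p, n ∉ V p := fun p hp n hU hV =>
    Multiset.disjoint_left.1 (hdisj p hp) hU hV
  have hle : ∀ p ∈ P, ∀ s ∈ P, p * (U s + V s).sup ≤ s * (U p + V p).sup := by
    intro p hp s hs
    by_contra! hlt
    have h := count_max_exponent hf (hP p hp).one_lt (hP s hs).one_lt (hMpos s hs)
      (hUb p hp) (hVb p hp) (hUb s hs) (hVb s hs) (hrep p hp) (hrep s hs) hlt.le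
    rw [Multiset.count_map_mul_eq_zero_of_lt (fun u hu => (hUb p hp u hu).2) hlt,
      Multiset.count_map_mul_eq_zero_of_lt (fun v hv => (hVb p hp v hv).2) hlt,
      zero_add, add_zero] at h
    rcases hmem s hs with hm | hm
    · exact hnot s hs _ hm (Multiset.count_pos.1 (h ▸ Multiset.count_pos.2 hm))
    · exact hnot s hs _ (Multiset.count_pos.1 (h ▸ Multiset.count_pos.2 hm)) hm
  have heq : ∀ p ∈ P, ∀ s ∈ P, p * (U s + V s).sup = s * (U p + V p).sup :=
    fun p hp s hs => le_antisymm (hle p hp s hs) (hle s hs p hp)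
  have hcount : ∀ p ∈ P, ∀ s ∈ P,
      (U s).count (U s + V s).sup + (V p).count (U p + V p).sup =
        (U p).count (U p + V p).sup + (V s).count (U s + V s).sup := by
    intro p hp s hs
    have h := count_max_exponent hf (hP p hp).one_lt (hP s hs).one_lt (hMpos s hs)
      (hUb p hp) (hVb p hp) (hUb s hs) (hVb s hs) (hrep p hp) (hrep s hs) (heq p hp s hs).ge
    rwa [heq p hp s hs, count_map_mul_left (hP s hs).pos,
      count_map_mul_left (hP s hs).pos] at h
  obtain ⟨p, hp, s, hs, hps⟩ := hP2
  obtain ⟨r, hr⟩ : p ∣ (U p + V p).sup :=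
    ((Nat.coprime_primes (hP p hp) (hP s hs)).2 hps).dvd_of_dvd_mul_left
      (Dvd.intro _ (heq p hp s hs))
  refine ⟨r, Nat.pos_of_mul_pos_left (hr ▸ hMpos p hp), fun t ht => ?_, ?_⟩
  · refine Nat.eq_of_mul_eq_mul_left (hP p hp).pos ?_
    rw [heq p hp t ht, hr]
    ring
  · refine (hmem p hp).imp (fun hm t ht => (hmem t ht).resolve_right fun hm' => ?_)
      (fun hm t ht => (hmem t ht).resolve_left fun hm' => ?_)
    · have h := hcount p hp t ht
      have h1 := Multiset.count_eq_zero.2 (hnot p hp _ hm)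
      have h2 := Multiset.count_eq_zero.2 fun hu => hnot t ht _ hu hm'
      have h3 := Multiset.count_pos.2 hm
      omega
    · have h := hcount p hp t ht
      have h1 := Multiset.count_eq_zero.2 (hnot t ht _ hm')
      have h2 := Multiset.count_eq_zero.2 fun hu => hnot p hp _ hu hm
      have h3 := Multiset.count_pos.2 hm'
      omega
end

section
/- Let P be a set of prime numbers and let {h_p(q) : p ∈ P} be a family of nonzero rational functions over ℚ satisfying the commutativity condition h_{p₁}(q)·h_{p₂}(q^{p₁}) = h_{p₂}(q)·h_{p₁}(q^{p₂}) for all p₁, p₂ ∈ P. Then there exists a unique sequence F = {f_n(q)}_{n=1}^∞ of rational functions over ℚ satisfying the functional equation for multiplication of quantum integers such that supp(F) = S(P) and f_p(q) = h_p(q) for all p ∈ P. -/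
open Polynomial

/-- The `ℚ`-algebra map `ℚ[X] → RatFunc ℚ` with `X ↦ q ^ m` is injective when `m` is positive. -/
theorem eval₂_X_pow_injective {m : ℕ} (hm : 0 < m) :
    Function.Injective (eval₂RingHom (RatFunc.C (K := ℚ)) (RatFunc.X ^ m)) := by
  have key : ∀ p : ℚ[X], eval₂RingHom (RatFunc.C (K := ℚ)) (RatFunc.X ^ m) p =
      algebraMap ℚ[X] (RatFunc ℚ) (expand ℚ m p) := by
    intro p
    rw [expand_eq_sum, coe_eval₂RingHom, eval₂_eq_sum]
    simp [Polynomial.sum, RatFunc.algebraMap_C, RatFunc.algebraMap_X]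
  intro p r hpr
  rw [key, key] at hpr
  exact expand_injective hm (RatFunc.algebraMap_injective ℚ hpr)

/-- For positive `m`, the substitution `q ↦ q ^ m` as a ring endomorphism of `RatFunc ℚ`. -/
noncomputable def qSubstHom (m : ℕ) (hm : 0 < m) : RatFunc ℚ →+* RatFunc ℚ :=
  RatFunc.liftRingHom (eval₂RingHom RatFunc.C (RatFunc.X ^ m))
    (nonZeroDivisors_le_comap_nonZeroDivisors_of_injective _ (eval₂_X_pow_injective hm))

theorem qSubst_eq_qSubstHom {m : ℕ} (hm : 0 < m) (f : RatFunc ℚ) :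
    qSubst m f = qSubstHom m hm f := by
  conv_rhs => rw [← RatFunc.num_div_denom f]
  rw [qSubstHom, RatFunc.liftRingHom_apply_div]
  rfl

theorem qSubst_mul {m : ℕ} (hm : 0 < m) (f g : RatFunc ℚ) :
    qSubst m (f * g) = qSubst m f * qSubst m g := by
  simp only [qSubst_eq_qSubstHom hm, map_mul]

theorem qSubst_one_right {m : ℕ} (hm : 0 < m) : qSubst m 1 = 1 := by
  simp only [qSubst_eq_qSubstHom hm, map_one]

theorem qSubst_eq_zero_iff {m : ℕ} (hm : 0 < m) {f : RatFunc ℚ} :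
    qSubst m f = 0 ↔ f = 0 := by
  rw [qSubst_eq_qSubstHom hm, map_eq_zero]

theorem qSubst_zero_right {m : ℕ} (hm : 0 < m) : qSubst m 0 = 0 :=
  (qSubst_eq_zero_iff hm).2 rfl

theorem qSubst_one_left (f : RatFunc ℚ) : qSubst 1 f = f := by
  have hX (p : ℚ[X]) : p.eval₂ RatFunc.C (RatFunc.X ^ 1) = algebraMap ℚ[X] (RatFunc ℚ) p := by
    rw [pow_one, ← RatFunc.algebraMap_X, ← RatFunc.algebraMap_comp_C, ← hom_eval₂, eval₂_C_X]
  rw [qSubst, hX, hX, RatFunc.num_div_denom]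

theorem qSubst_qSubst {m : ℕ} (hm : 0 < m) (n : ℕ) (f : RatFunc ℚ) :
    qSubst m (qSubst n f) = qSubst (m * n) f := by
  have hC (a : ℚ) : qSubstHom m hm (RatFunc.C a) = RatFunc.C a := by
    rw [← RatFunc.algebraMap_C, qSubstHom, RatFunc.liftRingHom_algebraMap]
    simp
  have hX : qSubstHom m hm RatFunc.X = RatFunc.X ^ m := by
    rw [← RatFunc.algebraMap_X, qSubstHom, RatFunc.liftRingHom_algebraMap]
    simp
  have hcomp : (qSubstHom m hm).comp RatFunc.C = RatFunc.C := RingHom.ext hC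
  rw [qSubst_eq_qSubstHom hm, qSubst, map_div₀, hom_eval₂, hom_eval₂, hcomp, map_pow, hX,
    ← pow_mul, qSubst]

/-- The sequence obtained from the values `H p` at primes `p` by splitting off the least prime
factor of the index. -/
noncomputable def extendFromPrimes (H : ℕ → RatFunc ℚ) (n : ℕ) : RatFunc ℚ :=
  if _hn : 1 < n then
    H n.minFac * qSubst n.minFac (extendFromPrimes H (n / n.minFac))
  else 1
termination_by n
decreasing_by exact Nat.div_lt_self (by omega) (Nat.minFac_prime (by omega)).one_lt

theorem extendFromPrimes_one (H : ℕ → RatFunc ℚ) : extendFromPrimes H 1 = 1 := by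
  rw [extendFromPrimes, dif_neg (lt_irrefl 1)]

theorem extendFromPrimes_of_minFac_mul (H : ℕ → RatFunc ℚ) {p n : ℕ} (hp : p.Prime)
    (hn : 0 < n) (hmin : (p * n).minFac = p) :
    extendFromPrimes H (p * n) = H p * qSubst p (extendFromPrimes H n) := by
  have h1 : 1 < p * n := lt_of_lt_of_le hp.one_lt (Nat.le_mul_of_pos_right p hn)
  rw [extendFromPrimes, dif_pos h1, hmin, Nat.mul_div_cancel_left n hp.pos]

theorem extendFromPrimes_prime_mul {H : ℕ → RatFunc ℚ}
    (hH : ∀ p r : ℕ, p.Prime → r.Prime → H p * qSubst p (H r) = H r * qSubst r (H p))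
    {p : ℕ} (hp : p.Prime) {n : ℕ} (hn : 0 < n) :
    extendFromPrimes H (p * n) = H p * qSubst p (extendFromPrimes H n) := by
  induction n using Nat.strong_induction_on generalizing p with
  | _ n ih =>
    by_cases hmin : (p * n).minFac = p
    · exact extendFromPrimes_of_minFac_mul H hp hn hmin
    have hr : (p * n).minFac.Prime :=
      Nat.minFac_prime fun h1 => hp.one_lt.ne' (Nat.eq_one_of_mul_eq_one_right h1)
    obtain ⟨r, hrdef⟩ : ∃ r, (p * n).minFac = r := ⟨_, rfl⟩
    rw [hrdef] at hmin hr
    obtain ⟨k, rfl⟩ : r ∣ n :=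
      ((hr.dvd_mul).1 (hrdef ▸ Nat.minFac_dvd (p * n))).resolve_left
        fun h1 => hmin ((Nat.prime_dvd_prime_iff_eq hr hp).1 h1)
    have hk : 0 < k := Nat.pos_of_mul_pos_left hn
    have hlt : k < r * k := lt_mul_of_one_lt_left hk hr.one_lt
    rw [mul_left_comm] at hrdef ⊢
    rw [extendFromPrimes_of_minFac_mul H hr (Nat.mul_pos hp.pos hk) hrdef,
      ih k hlt hp hk, ih k hlt hr hk, qSubst_mul hr.pos, qSubst_mul hp.pos,
      qSubst_qSubst hr.pos, qSubst_qSubst hp.pos, ← mul_assoc, ← mul_assoc,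
      hH r p hr hp, mul_comm r p]

theorem extendFromPrimes_prime (H : ℕ → RatFunc ℚ) {p : ℕ} (hp : p.Prime) :
    extendFromPrimes H p = H p := by
  have h1 := extendFromPrimes_of_minFac_mul H hp one_pos (by rw [mul_one, hp.minFac_eq])
  rwa [mul_one, extendFromPrimes_one, qSubst_one_right hp.pos, mul_one] at h1

theorem satisfiesFE_extendFromPrimes {H : ℕ → RatFunc ℚ}
    (hH : ∀ p r : ℕ, p.Prime → r.Prime → H p * qSubst p (H r) = H r * qSubst r (H p)) :
    SatisfiesFE (extendFromPrimes H) := by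
  intro m n hm hn
  induction m using induction_on_primes with
  | zero => exact absurd hm (lt_irrefl 0)
  | one => rw [one_mul, extendFromPrimes_one, one_mul, qSubst_one_left]
  | prime_mul p a hp ih =>
    have ha : 0 < a := Nat.pos_of_mul_pos_left hm
    rw [mul_assoc, extendFromPrimes_prime_mul hH hp (Nat.mul_pos ha hn), ih ha,
      extendFromPrimes_prime_mul hH hp ha, qSubst_mul hp.pos, qSubst_qSubst hp.pos, mul_assoc]

theorem one_mem_SP (P : Set ℕ) : 1 ∈ SP P :=
  ⟨one_pos, fun _ hp h1 => absurd (Nat.dvd_one.1 h1) hp.ne_one⟩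

theorem prime_mul_mem_SP_iff {P : Set ℕ} {p n : ℕ} (hp : p.Prime) (hn : 0 < n) :
    p * n ∈ SP P ↔ p ∈ P ∧ n ∈ SP P := by
  constructor
  · rintro ⟨-, h2⟩
    exact ⟨h2 p hp (dvd_mul_right p n), hn, fun r hr hrn => h2 r hr (hrn.mul_left p)⟩
  · rintro ⟨h1, -, h2⟩
    refine ⟨Nat.mul_pos hp.pos hn, fun r hr hrn => ?_⟩
    rcases (hr.dvd_mul).1 hrn with h3 | h3
    · rwa [(Nat.prime_dvd_prime_iff_eq hr hp).1 h3]
    · exact h2 r hr h3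

theorem prime_mem_SP_iff {P : Set ℕ} {p : ℕ} (hp : p.Prime) : p ∈ SP P ↔ p ∈ P := by
  simpa [one_mem_SP P] using prime_mul_mem_SP_iff (P := P) hp one_pos

/-- A solution that does not vanish at `1` takes the value `1` there. -/
theorem SatisfiesFE.map_one {f : ℕ → RatFunc ℚ} (hf : SatisfiesFE f) (h1 : f 1 ≠ 0) :
    f 1 = 1 := by
  have h2 := hf 1 1 one_pos one_pos
  rw [mul_one, qSubst_one_left] at h2
  exact (mul_eq_left₀ h1).1 h2.symm

/-- A solution that does not vanish at `1` is determined by its values at the primes. -/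
theorem SatisfiesFE.eq_of_eq_on_primes {f g : ℕ → RatFunc ℚ} (hf : SatisfiesFE f)
    (hg : SatisfiesFE g) (hf1 : f 1 ≠ 0) (hg1 : g 1 ≠ 0) (hfg : ∀ p : ℕ, p.Prime → g p = f p)
    {n : ℕ} (hn : 0 < n) : g n = f n := by
  induction n using induction_on_primes with
  | zero => exact absurd hn (lt_irrefl 0)
  | one => rw [hf.map_one hf1, hg.map_one hg1]
  | prime_mul p a hp ih =>
    have ha : 0 < a := Nat.pos_of_mul_pos_left hn
    rw [hf p a hp.pos ha, hg p a hp.pos ha, ih ha, hfg p hp]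

/-- The support of a solution that does not vanish at `1` is generated by the primes in it. -/
theorem SatisfiesFE.ne_zero_iff_mem_SP {f : ℕ → RatFunc ℚ} (hf : SatisfiesFE f) (hf1 : f 1 ≠ 0)
    {P : Set ℕ} (hP : ∀ p : ℕ, p.Prime → (f p ≠ 0 ↔ p ∈ P)) {n : ℕ} (hn : 0 < n) :
    f n ≠ 0 ↔ n ∈ SP P := by
  induction n using induction_on_primes with
  | zero => exact absurd hn (lt_irrefl 0)
  | one => exact iff_of_true hf1 (one_mem_SP P)
  | prime_mul p a hp ih =>
    have ha : 0 < a := Nat.pos_of_mul_pos_left hn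
    rw [hf p a hp.pos ha, mul_ne_zero_iff, Ne, Ne, qSubst_eq_zero_iff hp.pos,
      prime_mul_mem_SP_iff hp ha, ← ih ha, ← hP p hp]

/-- Let `P` be a set of primes and `{h_p : p ∈ P}` nonzero rational functions over
`ℚ` satisfying the commutativity condition
`h_{p₁}(q)·h_{p₂}(q^{p₁}) = h_{p₂}(q)·h_{p₁}(q^{p₂})` for all `p₁, p₂ ∈ P`.
Then there is a unique solution `F = {f_n(q)}` of the functional equation for
multiplication of quantum integers with `supp(F) = S(P)` and `f_p = h_p` for all
`p ∈ P`. -/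
theorem exists_unique_solution_extending (P : Set ℕ) (hP : ∀ p ∈ P, p.Prime)
    (h : ℕ → RatFunc ℚ) (hne : ∀ p ∈ P, h p ≠ 0)
    (hcomm : ∀ p₁ ∈ P, ∀ p₂ ∈ P,
      h p₁ * qSubst p₁ (h p₂) = h p₂ * qSubst p₂ (h p₁)) :
    ∃ f : ℕ → RatFunc ℚ,
      (SatisfiesFE f ∧ (∀ n : ℕ, 0 < n → (f n ≠ 0 ↔ n ∈ SP P)) ∧ ∀ p ∈ P, f p = h p) ∧
      ∀ g : ℕ → RatFunc ℚ,
        (SatisfiesFE g ∧ (∀ n : ℕ, 0 < n → (g n ≠ 0 ↔ n ∈ SP P)) ∧ ∀ p ∈ P, g p = h p) →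
        ∀ n : ℕ, 0 < n → g n = f n := by
  classical
  let H : ℕ → RatFunc ℚ := fun p => if p ∈ P then h p else 0
  have H_of_mem {p : ℕ} (hp : p ∈ P) : H p = h p := if_pos hp
  have H_of_notMem {p : ℕ} (hp : p ∉ P) : H p = 0 := if_neg hp
  have hH : ∀ p r : ℕ, p.Prime → r.Prime → H p * qSubst p (H r) = H r * qSubst r (H p) := by
    intro p r hp hr
    by_cases hpP : p ∈ P
    · by_cases hrP : r ∈ P
      · rw [H_of_mem hpP, H_of_mem hrP, hcomm p hpP r hrP]
      · rw [H_of_notMem hrP, qSubst_zero_right hp.pos, mul_zero, zero_mul]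
    · rw [H_of_notMem hpP, qSubst_zero_right hr.pos, mul_zero, zero_mul]
  have hFE := satisfiesFE_extendFromPrimes hH
  have hone : extendFromPrimes H 1 ≠ 0 := by
    rw [extendFromPrimes_one]
    exact one_ne_zero
  refine ⟨extendFromPrimes H, ⟨hFE, fun n hn => hFE.ne_zero_iff_mem_SP hone ?_ hn, ?_⟩, ?_⟩
  · intro p hp
    rw [extendFromPrimes_prime H hp]
    by_cases hpP : p ∈ P
    · rw [H_of_mem hpP]
      exact iff_of_true (hne p hpP) hpP
    · rw [H_of_notMem hpP]
      exact iff_of_false (not_not_intro rfl) hpP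
  · intro p hp
    rw [extendFromPrimes_prime H (hP p hp), H_of_mem hp]
  · rintro g ⟨hg, hsupp, hgP⟩ n hn
    refine hFE.eq_of_eq_on_primes hg hone ((hsupp 1 one_pos).2 (one_mem_SP P)) ?_ hn
    intro p hp
    rw [extendFromPrimes_prime H hp]
    by_cases hpP : p ∈ P
    · rw [H_of_mem hpP, hgP p hpP]
    · rw [H_of_notMem hpP]
      by_contra hgp
      exact hpP ((prime_mem_SP_iff hp).1 ((hsupp p hp.pos).1 hgp))
end
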